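/- Let R be a ring, A a left R-module, and n a non-negative integer. If the Gorenstein projective dimension of A equals n, then there exists a short exact sequence 0 → A → B → T → 0 of left R-modules with pd_R B = n and T Gorenstein projective. -/

import Mathlib

open CategoryTheory CategoryTheory.Limits CategoryTheory.Abelian ZeroObject

universe w v u

namespace RelHomDim

variable {𝒜 : Type u} [Category.{v} 𝒜] [Abelian 𝒜]

/-- A class of objects of an abelian category corresponding to a full additive
subcategory: it is closed under isomorphisms, contains a zero object and is
closed under finite direct sums (biproducts). -/
def IsAdditiveClass (P : 𝒜 → Prop) : Prop :=
  P 0 ∧ (∀ ⦃X Y : 𝒜⦄, (X ≅ Y) → P X → P Y) ∧ ∀ ⦃X Y : 𝒜⦄, P X → P Y → P (X ⊞ Y)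

/-- A class of objects is closed under direct summands. -/
def ClosedUnderSummands (P : 𝒜 → Prop) : Prop :=
  ∀ X Y : 𝒜, P (X ⊞ Y) → P X ∧ P Y

/-- `Hom(W,-)`-exactness of a short exact sequence `0 → X₁ → X₂ → X₃ → 0`:
the induced sequence `0 → Hom(W,X₁) → Hom(W,X₂) → Hom(W,X₃) → 0` is exact. -/
def CovHomExact (W : 𝒜) (S : ShortComplex 𝒜) : Prop :=
  (∀ a b : W ⟶ S.X₁, a ≫ S.f = b ≫ S.f → a = b) ∧
  (∀ b : W ⟶ S.X₂, b ≫ S.g = 0 → ∃ a : W ⟶ S.X₁, a ≫ S.f = b) ∧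
  (∀ c : W ⟶ S.X₃, ∃ b : W ⟶ S.X₂, b ≫ S.g = c)

/-- A short exact sequence is `ℰ`-proper (i.e. `Hom(ℰ,-)`-exact) if it is
`Hom(E,-)`-exact for every object `E` in the class `ℰ`. -/
def EProper (E : 𝒜 → Prop) (S : ShortComplex 𝒜) : Prop :=
  ∀ W, E W → CovHomExact W S

/-- `ResW P W n K A` holds iff there is an exact sequence
`0 → K → X_{n-1} → ⋯ → X_0 → A → 0` in `𝒜` with all the `n` middle terms `X i`
in `P`, such that each of the short exact sequences obtained by splicing
satisfies `W` (this encodes, e.g., `Hom(ℰ,-)`-exactness of the whole sequence). -/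
def ResW (P : 𝒜 → Prop) (W : ShortComplex 𝒜 → Prop) : ℕ → 𝒜 → 𝒜 → Prop
  | 0 => fun K A => Nonempty (K ≅ A)
  | n + 1 => fun K A => ∃ (B X : 𝒜) (f : B ⟶ X) (g : X ⟶ A) (w : f ≫ g = 0),
      P X ∧ (ShortComplex.mk f g w).ShortExact ∧ W (ShortComplex.mk f g w) ∧
      ResW P W n K B

/-- `Res P n K A` : there is an exact sequence `0 → K → X_{n-1} → ⋯ → X_0 → A → 0`
with all middle terms in `P`. -/
abbrev Res (P : 𝒜 → Prop) : ℕ → 𝒜 → 𝒜 → Prop := ResW P fun _ => True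

/-- `CoresW P W n A K` holds iff there is an exact sequence
`0 → A → X^0 → ⋯ → X^{n-1} → K → 0` with all middle terms in `P` and each
spliced short exact piece satisfying `W`. -/
def CoresW (P : 𝒜 → Prop) (W : ShortComplex 𝒜 → Prop) : ℕ → 𝒜 → 𝒜 → Prop
  | 0 => fun A K => Nonempty (A ≅ K)
  | n + 1 => fun A K => ∃ (X B : 𝒜) (f : A ⟶ X) (g : X ⟶ B) (w : f ≫ g = 0),
      P X ∧ (ShortComplex.mk f g w).ShortExact ∧ W (ShortComplex.mk f g w) ∧
      CoresW P W n B K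

/-- `Cores P n A K` : there is an exact sequence `0 → A → X^0 → ⋯ → X^{n-1} → K → 0`
with all middle terms in `P`. -/
abbrev Cores (P : 𝒜 → Prop) : ℕ → 𝒜 → 𝒜 → Prop := CoresW P fun _ => True

/-- The `P`-dimension of `A` : the infimum of the `n ≥ 0` such that there is
an exact sequence `0 → C_n → ⋯ → C_1 → C_0 → A → 0` with all `C_i` in `P`
(`⊤ = ∞` if there is no such `n`). -/
noncomputable def rdim (P : 𝒜 → Prop) (A : 𝒜) : ℕ∞ :=
  sInf {c : ℕ∞ | ∃ n : ℕ, c = n ∧ ∃ K, P K ∧ Res P n K A}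

/-- The `P`-codimension of `A` : the infimum of the `n ≥ 0` such that there is
an exact sequence `0 → A → C^0 → C^1 → ⋯ → C^n → 0` with all `C^i` in `P`
(`⊤ = ∞` if there is no such `n`). -/
noncomputable def rcodim (P : 𝒜 → Prop) (A : 𝒜) : ℕ∞ :=
  sInf {c : ℕ∞ | ∃ n : ℕ, c = n ∧ ∃ K, P K ∧ Cores P n A K}

/-- `A` belongs to `P^⊥`, i.e. `Ext^i(C, A) = 0` for all `C` in `P` and `i ≥ 1`. -/
def MemRightPerp [HasExt.{w} 𝒜] (P : 𝒜 → Prop) (A : 𝒜) : Prop :=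
  ∀ C, P C → ∀ i : ℕ, 1 ≤ i → Subsingleton (Abelian.Ext C A i)

/-- `A` belongs to `^⊥P`, i.e. `Ext^i(A, C) = 0` for all `C` in `P` and `i ≥ 1`. -/
def MemLeftPerp [HasExt.{w} 𝒜] (P : 𝒜 → Prop) (A : 𝒜) : Prop :=
  ∀ C, P C → ∀ i : ℕ, 1 ≤ i → Subsingleton (Abelian.Ext A C i)

/-- `𝒞` is an `ℰ`-proper generator for `𝒯` (`𝒞 ⊆ 𝒯` and every object of `𝒯`
is an `ℰ`-proper quotient of an object of `𝒞` with kernel in `𝒯`). -/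
def IsProperGenerator (E C T : 𝒜 → Prop) : Prop :=
  (∀ ⦃X⦄, C X → T X) ∧
  ∀ X, T X → ∃ (X' Cb : 𝒜) (f : X' ⟶ Cb) (g : Cb ⟶ X) (w : f ≫ g = 0),
    C Cb ∧ T X' ∧ (ShortComplex.mk f g w).ShortExact ∧ EProper E (ShortComplex.mk f g w)

/-- `𝒞` is a cogenerator for `𝒯`. -/
def IsCogenerator (C T : 𝒜 → Prop) : Prop :=
  (∀ ⦃X⦄, C X → T X) ∧
  ∀ X, T X → ∃ (Cb X' : 𝒜) (f : X ⟶ Cb) (g : Cb ⟶ X') (w : f ≫ g = 0),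
    C Cb ∧ T X' ∧ (ShortComplex.mk f g w).ShortExact

/-- `𝒯` is closed under `ℰ`-proper extensions. -/
def ClosedUnderProperExtensions (E T : 𝒜 → Prop) : Prop :=
  ∀ S : ShortComplex 𝒜, S.ShortExact → EProper E S → T S.X₁ → T S.X₃ → T S.X₂

/-- `𝒯` is closed under kernels of `ℰ`-proper epimorphisms. -/
def ClosedUnderProperKernels (E T : 𝒜 → Prop) : Prop :=
  ∀ S : ShortComplex 𝒜, S.ShortExact → EProper E S → T S.X₂ → T S.X₃ → T S.X₁

/-- `𝒯` is an `ℰ`-preresolving subcategory with `ℰ`-proper generator `𝒞`. -/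
def IsPreresolving (E T C : 𝒜 → Prop) : Prop :=
  IsProperGenerator E C T ∧ ClosedUnderProperExtensions E T


/-- Exactness of a four-term sequence `0 → M → T₁ → T₀ → A → 0`. -/
def FourTermExact {M T1 T0 A : 𝒜} (f : M ⟶ T1) (g : T1 ⟶ T0) (h : T0 ⟶ A) : Prop :=
  Mono f ∧ Epi h ∧ ∃ (w₁ : f ≫ g = 0) (w₂ : g ≫ h = 0),
    (ShortComplex.mk f g w₁).Exact ∧ (ShortComplex.mk g h w₂).Exact

/-- `Hom(W,-)`-exactness of the four-term exact sequence `0 → M → T₁ → T₀ → A → 0` :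
the induced sequence `0 → Hom(W,M) → Hom(W,T₁) → Hom(W,T₀) → Hom(W,A) → 0` is exact. -/
def CovHomExact4 (W : 𝒜) {M T1 T0 A : 𝒜} (f : M ⟶ T1) (g : T1 ⟶ T0) (h : T0 ⟶ A) : Prop :=
  (∀ a b : W ⟶ M, a ≫ f = b ≫ f → a = b) ∧
  (∀ b : W ⟶ T1, b ≫ g = 0 → ∃ a : W ⟶ M, a ≫ f = b) ∧
  (∀ c : W ⟶ T0, c ≫ h = 0 → ∃ b : W ⟶ T1, b ≫ g = c) ∧
  (∀ d : W ⟶ A, ∃ c : W ⟶ T0, c ≫ h = d)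

/-- There is an exact sequence `0 → M → K⁰ → C¹ → ⋯ → Cⁿ → 0` with `K⁰` in `T`
and all `C^i` in `C`. -/
def MixedCores (T C : 𝒜 → Prop) : ℕ → 𝒜 → Prop
  | 0 => fun M => ∃ K, T K ∧ Nonempty (M ≅ K)
  | n + 1 => fun M => ∃ (K H : 𝒜) (f : M ⟶ K) (g : K ⟶ H) (w : f ≫ g = 0),
      T K ∧ (ShortComplex.mk f g w).ShortExact ∧ ∃ K', C K' ∧ Cores C n H K'

/-- The Gorenstein subcategory `𝒢(𝒞)` : objects `A` admitting a doubly infinite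
exact sequence `⋯ → X_{-1} → X_0 → X_1 → ⋯` with all terms in `𝒞`, which is both
`Hom(𝒞,-)`-exact and `Hom(-,𝒞)`-exact, such that `A ≅ Im(X_0 → X_1)`. -/
def IsGorenstein (P : 𝒜 → Prop) (A : 𝒜) : Prop :=
  ∃ (X : ℤ → 𝒜) (d : ∀ i : ℤ, X i ⟶ X (i + 1)) (w : ∀ i, d i ≫ d (i + 1) = 0),
    (∀ i, P (X i)) ∧
    (∀ i, (ShortComplex.mk (d i) (d (i + 1)) (w i)).Exact) ∧
    (∀ C, P C → ∀ (i : ℤ) (f : C ⟶ X (i + 1)), f ≫ d (i + 1) = 0 →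
      ∃ g : C ⟶ X i, g ≫ d i = f) ∧
    (∀ C, P C → ∀ (i : ℤ) (f : X (i + 1) ⟶ C), d i ≫ f = 0 →
      ∃ g : X (i + 1 + 1) ⟶ C, d (i + 1) ≫ g = f) ∧
    Nonempty (A ≅ Limits.image (d 0))


section Modules

variable (R : Type u) [Ring R]

/-- `G` is isomorphic to the image of the middle map of a doubly infinite exact
sequence of projective `R`-modules which stays exact under `Hom(-, F)` for every
module `F` satisfying `Q`. -/
def IsTotallyAcyclicImageFor (Q : ModuleCat.{u} R → Prop) (G : ModuleCat.{u} R) : Prop :=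
  ∃ (X : ℤ → ModuleCat.{u} R) (d : ∀ i : ℤ, X i ⟶ X (i + 1)) (w : ∀ i, d i ≫ d (i + 1) = 0),
    (∀ i, Projective (X i)) ∧
    (∀ i, (ShortComplex.mk (d i) (d (i + 1)) (w i)).Exact) ∧
    (∀ F, Q F → ∀ (i : ℤ) (f : X (i + 1) ⟶ F), d i ≫ f = 0 →
      ∃ g : X (i + 1 + 1) ⟶ F, d (i + 1) ≫ g = f) ∧
    Nonempty (G ≅ Limits.image (d 0))

/-- Gorenstein projective modules. -/
def IsGorensteinProjective (G : ModuleCat.{u} R) : Prop :=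
  IsTotallyAcyclicImageFor R (fun Q => Projective Q) G

/-- Flatness of a left module over an arbitrary ring, via the Lazard–Govorov
characterization: a module is flat iff every homomorphism from a finitely
presented module to it factors through a finitely generated free module. -/
def IsFlatModule (F : ModuleCat.{u} R) : Prop :=
  ∀ (P : ModuleCat.{u} R), Module.FinitePresentation R P → ∀ f : P ⟶ F,
    ∃ (n : ℕ) (g : P ⟶ ModuleCat.of R (Fin n → R)) (h : ModuleCat.of R (Fin n → R) ⟶ F),
      g ≫ h = f

/-- Strongly Gorenstein flat modules. -/
def IsStronglyGorensteinFlat (G : ModuleCat.{u} R) : Prop :=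
  IsTotallyAcyclicImageFor R (fun F => IsFlatModule R F) G

end Modules

end RelHomDim

namespace RelHomDim

variable {𝒜 : Type u} [Category.{v} 𝒜] [Abelian 𝒜]

/-- There is a short exact sequence `0 → X → Y → Z → 0`. -/
def HasSES (X Y Z : 𝒜) : Prop :=
  ∃ (f : X ⟶ Y) (g : Y ⟶ Z) (w : f ≫ g = 0), (ShortComplex.mk f g w).ShortExact

lemma shortExact_cokernel {X Y : 𝒜} (f : X ⟶ Y) [Mono f] :
    (ShortComplex.mk f (cokernel.π f) (cokernel.condition f)).ShortExact where
  exact := ShortComplex.exact_cokernel f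
  mono_f := inferInstanceAs (Mono f)
  epi_g := inferInstanceAs (Epi (cokernel.π f))

lemma shortExact_kernel {X Y : 𝒜} (f : X ⟶ Y) [Epi f] :
    (ShortComplex.mk (kernel.ι f) f (kernel.condition f)).ShortExact where
  exact := ShortComplex.exact_kernel f
  mono_f := inferInstanceAs (Mono (kernel.ι f))
  epi_g := inferInstanceAs (Epi f)

lemma exact_iff_of_epi_comp_of_comp_mono {W X Y Z V : 𝒜} (e : W ⟶ X) [Epi e] (m : Z ⟶ V) [Mono m]
    {f : X ⟶ Y} {g : Y ⟶ Z} {f' : W ⟶ Y} {g' : Y ⟶ V} (w : f ≫ g = 0) (w' : f' ≫ g' = 0)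
    (he : e ≫ f = f') (hm : g ≫ m = g') :
    (ShortComplex.mk f' g' w').Exact ↔ (ShortComplex.mk f g w).Exact := by
  let φ : ShortComplex.mk f' g (by rw [← he, Category.assoc, w, comp_zero]) ⟶
      ShortComplex.mk f' g' w' :=
    { τ₁ := 𝟙 _, τ₂ := 𝟙 _, τ₃ := m }
  let ψ : ShortComplex.mk f' g (by rw [← he, Category.assoc, w, comp_zero]) ⟶
      ShortComplex.mk f g w :=
    { τ₁ := e, τ₂ := 𝟙 _, τ₃ := 𝟙 _ }
  have : Epi ψ.τ₁ := inferInstanceAs (Epi e)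
  have : IsIso ψ.τ₂ := inferInstanceAs (IsIso (𝟙 _))
  have : Mono ψ.τ₃ := inferInstanceAs (Mono (𝟙 _))
  have : Epi φ.τ₁ := inferInstanceAs (Epi (𝟙 _))
  have : IsIso φ.τ₂ := inferInstanceAs (IsIso (𝟙 _))
  have : Mono φ.τ₃ := inferInstanceAs (Mono m)
  rw [← ShortComplex.exact_iff_of_epi_of_isIso_of_mono φ,
    ShortComplex.exact_iff_of_epi_of_isIso_of_mono ψ]

lemma shortExact_of_iso {X Y Z X' : 𝒜} (e : X' ≅ X) {f : X ⟶ Y} {g : Y ⟶ Z} {w : f ≫ g = 0}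
    (h : (ShortComplex.mk f g w).ShortExact) :
    (ShortComplex.mk (e.hom ≫ f) g (by rw [Category.assoc, w, comp_zero])).ShortExact :=
  ShortComplex.shortExact_of_iso
    (ShortComplex.isoMk e.symm (Iso.refl Y) (Iso.refl Z) (by simp) (by simp)) h

lemma HasSES.of_iso {X Y : 𝒜} (e : X ≅ Y) : HasSES X Y 0 :=
  ⟨e.hom, 0, comp_zero,
    { exact := (ShortComplex.exact_iff_epi _ rfl).2 (inferInstanceAs (Epi e.hom))
      mono_f := inferInstanceAs (Mono e.hom)
      epi_g := ⟨fun _ _ _ => (isZero_zero 𝒜).eq_of_src _ _⟩ }⟩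

lemma shortExact_of_isPushout {X Y Z X' Y' : 𝒜} {f : X ⟶ Y} {g : Y ⟶ Z} {w : f ≫ g = 0}
    (h : (ShortComplex.mk f g w).ShortExact) {a : X ⟶ X'} {b : Y ⟶ Y'} {f' : X' ⟶ Y'}
    (sq : IsPushout f a b f') :
    ∃ (g' : Y' ⟶ Z) (w' : f' ≫ g' = 0), (ShortComplex.mk f' g' w').ShortExact := by
  have hf : Mono f := h.mono_f
  have hg : Epi g := h.epi_g
  have hb : b ≫ sq.desc g 0 (by simp [w]) = g := sq.inl_desc _ _ _
  have w' : f' ≫ sq.desc g 0 (by simp [w]) = 0 := sq.inr_desc _ _ _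
  refine ⟨sq.desc g 0 (by simp [w]), w', ?_⟩
  have hepi : Epi (sq.desc g 0 (by simp [w])) := by
    have : Epi (b ≫ sq.desc g 0 (by simp [w])) := by rwa [hb]
    exact epi_of_epi b _
  have hdesc {W : 𝒜} (k : Y' ⟶ W) (hk : f' ≫ k = 0) :
      ∃ l : Z ⟶ W, sq.desc g 0 (by simp [w]) ≫ l = k := by
    have hk' : f ≫ b ≫ k = 0 := by rw [reassoc_of% sq.w, hk, comp_zero]
    refine ⟨h.exact.desc (b ≫ k) hk', sq.hom_ext ?_ ?_⟩
    · rw [reassoc_of% hb]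
      exact h.exact.g_desc _ _
    · rw [reassoc_of% w', zero_comp, hk]
  choose l hl using @hdesc
  exact
    { exact := ShortComplex.exact_of_g_is_cokernel _
        (CokernelCofork.IsColimit.ofπ _ w' (fun k hk => l k hk) (fun k hk => hl k hk)
          fun k hk m hm => by rw [← cancel_epi (sq.desc g 0 _), hl, hm])
      mono_f := (MorphismProperty.monomorphisms 𝒜).of_isPushout sq.flip hf
      epi_g := hepi }

/-- Pushout of a short exact sequence along the monomorphism of another one. -/
lemma HasSES.pushout {X Y Z X' Z' : 𝒜} (h : HasSES X Y Z) (h' : HasSES X X' Z') :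
    ∃ Y' : 𝒜, HasSES X' Y' Z ∧ HasSES Y Y' Z' := by
  obtain ⟨f, g, w, h⟩ := h
  obtain ⟨f', g', w', h'⟩ := h'
  have sq := IsPushout.of_hasPushout f f'
  exact ⟨_, ⟨_, shortExact_of_isPushout h sq⟩, ⟨_, shortExact_of_isPushout h' sq.flip⟩⟩

/-- For subobjects `X ≤ Y ≤ W`, the quotient `W/X` is an extension of `W/Y` by `Y/X`. -/
lemma HasSES.quotient {X Y Z W V : 𝒜} (h : HasSES X Y Z) (h' : HasSES Y W V) :
    ∃ C : 𝒜, HasSES X W C ∧ HasSES Z C V := by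
  obtain ⟨f, g, w, h⟩ := h
  obtain ⟨i, p, w', h'⟩ := h'
  have hf : Mono f := h.mono_f
  have hi : Mono i := h'.mono_f
  refine ⟨cokernel (f ≫ i), ⟨_, _, _, shortExact_cokernel (f ≫ i)⟩, ?_⟩
  have hw : f ≫ i ≫ cokernel.π (f ≫ i) = 0 := by
    rw [← Category.assoc, cokernel.condition]
  have : Epi g := h.epi_g
  have hg : g ≫ h.exact.desc (i ≫ cokernel.π (f ≫ i)) hw = i ≫ cokernel.π (f ≫ i) :=
    h.exact.g_desc _ _
  have sq : IsPushout i g (cokernel.π (f ≫ i)) (h.exact.desc (i ≫ cokernel.π (f ≫ i)) hw) := by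
    refine ⟨⟨hg.symm⟩, ⟨PushoutCocone.IsColimit.mk _
      (fun s => cokernel.desc _ s.inl (by simp [s.condition, reassoc_of% w])) ?_ ?_ ?_⟩⟩
    · intro s
      simp
    · intro s
      rw [← cancel_epi g, ← Category.assoc, hg]
      simp [s.condition]
    · intro s m hm _
      rw [← cancel_epi (cokernel.π (f ≫ i)), hm]
      simp
  exact ⟨_, shortExact_of_isPushout h' sq⟩

/-- The preimage `K` of a subobject `W` of `Z` under an epimorphism `Y ⟶ Z`. -/
lemma HasSES.preimage {X Y Z W V : 𝒜} (h : HasSES X Y Z) (h' : HasSES W Z V) :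
    ∃ K : 𝒜, HasSES K Y V ∧ HasSES X K W := by
  obtain ⟨f, g, w, h⟩ := h
  obtain ⟨i, p, w', h'⟩ := h'
  have op₁ : HasSES (Opposite.op Z) (Opposite.op Y) (Opposite.op X) :=
    ⟨_, _, _, h.op⟩
  have op₂ : HasSES (Opposite.op V) (Opposite.op Z) (Opposite.op W) :=
    ⟨_, _, _, h'.op⟩
  obtain ⟨C, ⟨a, b, hab, h₁⟩, ⟨c, d, hcd, h₂⟩⟩ := op₂.quotient op₁
  exact ⟨C.unop, ⟨_, _, _, h₁.unop⟩, ⟨_, _, _, h₂.unop⟩⟩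

lemma HasSES.swap_of_splitting {S : ShortComplex 𝒜} (s : S.Splitting) :
    HasSES S.X₃ S.X₂ S.X₁ :=
  ⟨s.s, s.r, s.s_r,
    (ShortComplex.Splitting.mk (S := ShortComplex.mk s.s s.r s.s_r) S.g S.f s.s_g s.f_r
      (by rw [add_comm]; exact s.id)).shortExact⟩

lemma HasSES.projective {X Y Z : 𝒜} (h : HasSES X Y Z) [Projective X] [Projective Z] :
    Projective Y := by
  obtain ⟨f, g, w, h⟩ := h
  have : Projective (ShortComplex.mk f g w).X₃ := inferInstanceAs (Projective Z)
  exact Projective.of_iso (h.splittingOfProjective.isoBinaryBiproduct).symm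
    (inferInstanceAs (Projective (X ⊞ Z)))

lemma exists_extension [HasExt.{w} 𝒜] {X Y Z Q : 𝒜} {f : X ⟶ Y} {g : Y ⟶ Z} {w : f ≫ g = 0}
    (h : (ShortComplex.mk f g w).ShortExact) [Subsingleton (Ext.{w} Z Q 1)] (k : X ⟶ Q) :
    ∃ l : Y ⟶ Q, f ≫ l = k := by
  obtain ⟨x, hx⟩ := Ext.contravariant_sequence_exact₁ h Q (Ext.mk₀ k) (add_zero 1)
    (Subsingleton.elim (α := Ext.{w} Z Q 1) _ _)
  obtain ⟨l, rfl⟩ := (Ext.mk₀_bijective Y Q).2 x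
  refine ⟨l, (Ext.mk₀_bijective X Q).1 ?_⟩
  rw [← hx]
  exact (Ext.mk₀_comp_mk₀ f l).symm

lemma HasSES.subsingleton_ext_middle [HasExt.{w} 𝒜] {X Y Z Q : 𝒜} (h : HasSES X Y Z) (n : ℕ)
    [Subsingleton (Ext.{w} X Q n)] [Subsingleton (Ext.{w} Z Q n)] :
    Subsingleton (Ext.{w} Y Q n) := by
  obtain ⟨f, g, w, h⟩ := h
  refine subsingleton_of_forall_eq 0 fun y => ?_
  obtain ⟨z, rfl⟩ := Ext.contravariant_sequence_exact₂ h Q y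
    (Subsingleton.elim (α := Ext.{w} X Q n) _ _)
  rw [Subsingleton.elim (α := Ext.{w} Z Q n) z 0, Ext.comp_zero]

lemma HasSES.subsingleton_ext_left [HasExt.{w} 𝒜] {X Y Z Q : 𝒜} (h : HasSES X Y Z) (n : ℕ)
    [Subsingleton (Ext.{w} Y Q n)] [Subsingleton (Ext.{w} Z Q (1 + n))] :
    Subsingleton (Ext.{w} X Q n) := by
  obtain ⟨f, g, w, h⟩ := h
  refine subsingleton_of_forall_eq 0 fun x => ?_
  obtain ⟨y, rfl⟩ := Ext.contravariant_sequence_exact₁ h Q x rfl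
    (Subsingleton.elim (α := Ext.{w} Z Q (1 + n)) _ _)
  rw [Subsingleton.elim (α := Ext.{w} Y Q n) y 0, Ext.comp_zero]

lemma HasSES.subsingleton_ext_right [HasExt.{w} 𝒜] {X Y Z Q : 𝒜} (h : HasSES X Y Z) (n : ℕ)
    [Subsingleton (Ext.{w} X Q n)] [Subsingleton (Ext.{w} Y Q (1 + n))] :
    Subsingleton (Ext.{w} Z Q (1 + n)) := by
  obtain ⟨f, g, w, h⟩ := h
  refine subsingleton_of_forall_eq 0 fun z => ?_
  obtain ⟨x, rfl⟩ := Ext.contravariant_sequence_exact₃ h Q z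
    (Subsingleton.elim (α := Ext.{w} Y Q (1 + n)) _ _) rfl
  rw [Subsingleton.elim (α := Ext.{w} X Q n) x 0, Ext.comp_zero]

lemma subsingleton_ext_one_of_forall_extension [HasExt.{w} 𝒜] {X Y Z Q : 𝒜} {f : X ⟶ Y}
    {g : Y ⟶ Z} {w : f ≫ g = 0} (h : (ShortComplex.mk f g w).ShortExact)
    [Subsingleton (Ext.{w} Y Q 1)] (hext : ∀ k : X ⟶ Q, ∃ l : Y ⟶ Q, f ≫ l = k) :
    Subsingleton (Ext.{w} Z Q 1) := by
  refine subsingleton_of_forall_eq 0 fun z => ?_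
  obtain ⟨x, rfl⟩ := Ext.contravariant_sequence_exact₃ h Q z
    (Subsingleton.elim (α := Ext.{w} Y Q 1) _ _) (add_zero 1)
  obtain ⟨k, rfl⟩ := (Ext.mk₀_bijective X Q).2 x
  obtain ⟨l, rfl⟩ := hext k
  rw [← Ext.mk₀_comp_mk₀]
  exact h.extClass_comp_assoc _

section GorensteinProjective

variable {R : Type u} [Ring R]

/-- `Ext^i(G, Q) = 0` for all projective modules `Q` and all `i ≥ 1`. -/
def PerpProjective (G : ModuleCat.{u} R) : Prop :=
  ∀ Q : ModuleCat.{u} R, Projective Q → ∀ i : ℕ, Subsingleton (Ext.{u} G Q (i + 1))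

lemma PerpProjective.of_projective (P : ModuleCat.{u} R) [Projective P] : PerpProjective P :=
  fun Q _ i => Ext.subsingleton_of_projective P Q i

lemma PerpProjective.middle {X Y Z : ModuleCat.{u} R} (h : HasSES X Y Z) (hX : PerpProjective X)
    (hZ : PerpProjective Z) : PerpProjective Y := fun Q hQ i =>
  have := hX Q hQ i
  have := hZ Q hQ i
  h.subsingleton_ext_middle (i + 1)

lemma PerpProjective.left {X Y Z : ModuleCat.{u} R} (h : HasSES X Y Z) (hY : PerpProjective Y)
    (hZ : PerpProjective Z) : PerpProjective X := fun Q hQ i =>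
  have := hY Q hQ i
  have : Subsingleton (Ext.{u} Z Q (1 + (i + 1))) := by
    rw [add_comm]
    exact hZ Q hQ (i + 1)
  h.subsingleton_ext_left (i + 1)

lemma PerpProjective.exists_syzygy {G : ModuleCat.{u} R} (hG : PerpProjective G) :
    ∃ P G' : ModuleCat.{u} R, Projective P ∧ HasSES G' P G ∧ PerpProjective G' := by
  have h : HasSES _ _ G := ⟨_, _, _, shortExact_kernel (Projective.π G)⟩
  exact ⟨_, _, inferInstance, h, .left h (.of_projective _) hG⟩

lemma isGorensteinProjective_of_int_sequence (K : ℤ → ModuleCat.{u} R)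
    (hperp : ∀ i, PerpProjective (K i))
    (hK : ∀ i, ∃ P : ModuleCat.{u} R, Projective P ∧ HasSES (K i) P (K (i + 1))) :
    IsGorensteinProjective R (K 1) := by
  choose X hX f g w h using hK
  have hf (i : ℤ) : Mono (f i) := (h i).mono_f
  have hg (i : ℤ) : Epi (g i) := (h i).epi_g
  refine ⟨X, fun i => g i ≫ f (i + 1), fun i => ?_, hX, fun i => ?_, fun Q hQ i k hk => ?_, ?_⟩
  · rw [Category.assoc, reassoc_of% (w (i + 1)), zero_comp, comp_zero]
  · exact (exact_iff_of_epi_comp_of_comp_mono (g i) (f (i + 1 + 1)) (w (i + 1)) _ rfl rfl).2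
      (h (i + 1)).exact
  · have hk' : f (i + 1) ≫ k = 0 := by
      rw [← cancel_epi (g i), ← Category.assoc, hk, comp_zero]
    have : Subsingleton (Ext.{u} (K (i + 1 + 1 + 1)) Q 1) := hperp _ Q hQ 0
    obtain ⟨l, hl⟩ := exists_extension (h (i + 1 + 1)) ((h (i + 1)).exact.desc k hk')
    refine ⟨l, ?_⟩
    rw [Category.assoc, hl]
    exact (h (i + 1)).exact.g_desc _ _
  · have : StrongEpi (g 0) := strongEpi_of_epi _
    exact ⟨image.isoStrongEpiMono (I' := K (0 + 1)) (g 0) (f (0 + 1)) rfl⟩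

/-- Coinduction principle for Gorenstein projective modules. -/
lemma isGorensteinProjective_of_class (S : ModuleCat.{u} R → Prop)
    (hperp : ∀ G, S G → PerpProjective G)
    (hS : ∀ G, S G → ∃ P G' : ModuleCat.{u} R, Projective P ∧ HasSES G P G' ∧ S G')
    {G : ModuleCat.{u} R} (hG : S G) : IsGorensteinProjective R G := by
  choose P G' hP hses hG' using hS
  choose P₁ G₁ hP₁ hses₁ hG₁ using fun (G : ModuleCat.{u} R) (hG : PerpProjective G) =>
    hG.exists_syzygy
  let fwd : {G : ModuleCat.{u} R // S G} → {G : ModuleCat.{u} R // S G} :=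
    fun G => ⟨G' G.1 G.2, hG' G.1 G.2⟩
  let bwd : {G : ModuleCat.{u} R // PerpProjective G} → {G : ModuleCat.{u} R // PerpProjective G} :=
    fun G => ⟨G₁ G.1 G.2, hG₁ G.1 G.2⟩
  let K : ℤ → ModuleCat.{u} R
    | .ofNat n => (fwd^[n] ⟨G, hG⟩).1
    | .negSucc n => (bwd^[n + 1] ⟨G, hperp G hG⟩).1
  have hK (i : ℤ) : PerpProjective (K i) := by
    cases i with
    | ofNat n => exact hperp _ (fwd^[n] ⟨G, hG⟩).2
    | negSucc n => exact (bwd^[n + 1] ⟨G, hperp G hG⟩).2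
  have hstep (i : ℤ) : ∃ P : ModuleCat.{u} R, Projective P ∧ HasSES (K i) P (K (i + 1)) := by
    match i with
    | .ofNat n =>
      have e : K (Int.ofNat n + 1) = (fwd (fwd^[n] ⟨G, hG⟩)).1 := by
        rw [← Function.iterate_succ_apply' fwd]
        rfl
      rw [e]
      exact ⟨_, hP _ (fwd^[n] ⟨G, hG⟩).2, hses _ _⟩
    | .negSucc 0 => exact ⟨_, hP₁ _ (hperp G hG), hses₁ _ _⟩
    | .negSucc (n + 1) =>
      have e : K (Int.negSucc (n + 1)) = (bwd (bwd^[n + 1] ⟨G, hperp G hG⟩)).1 := by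
        rw [← Function.iterate_succ_apply' bwd]
      rw [e]
      exact ⟨_, hP₁ _ (bwd^[n + 1] ⟨G, hperp G hG⟩).2, hses₁ _ _⟩
  refine isGorensteinProjective_of_int_sequence (fun i => K (i - 1)) (fun i => hK _) fun i => ?_
  have e : i + 1 - 1 = i - 1 + 1 := by ring
  simpa only [e] using hstep (i - 1)

lemma IsGorensteinProjective.of_iso {G G' : ModuleCat.{u} R} (e : G' ≅ G)
    (hG : IsGorensteinProjective R G) : IsGorensteinProjective R G' := by
  obtain ⟨X, d, w, hX, hd, hQ, ⟨e'⟩⟩ := hG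
  exact ⟨X, d, w, hX, hd, hQ, ⟨e ≪≫ e'⟩⟩

lemma shortExact_image {X Y Z : ModuleCat.{u} R} (f : X ⟶ Y) (g : Y ⟶ Z) (w : f ≫ g = 0)
    (h : (ShortComplex.mk f g w).Exact) :
    ∃ w', (ShortComplex.mk (Limits.image.ι f) (factorThruImage g) w').ShortExact := by
  have w' : Limits.image.ι f ≫ factorThruImage g = 0 := by
    rw [← cancel_epi (factorThruImage f), ← cancel_mono (Limits.image.ι g)]
    simp [w]
  refine ⟨w', { exact := ?_, mono_f := inferInstanceAs (Mono (Limits.image.ι f)),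
                epi_g := inferInstanceAs (Epi (factorThruImage g)) }⟩
  exact (exact_iff_of_epi_comp_of_comp_mono (factorThruImage f) (Limits.image.ι g) w' w
    (image.fac f) (image.fac g)).1 h

lemma IsGorensteinProjective.exists_cosyzygy {G : ModuleCat.{u} R}
    (hG : IsGorensteinProjective R G) :
    ∃ P G' : ModuleCat.{u} R, Projective P ∧ HasSES G P G' ∧ IsGorensteinProjective R G' := by
  obtain ⟨X, d, w, hX, hd, hQ, ⟨e⟩⟩ := hG
  obtain ⟨_, h⟩ := shortExact_image (d 0) (d (0 + 1)) (w 0) (hd 0)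
  exact ⟨_, _, hX _, ⟨_, _, _, shortExact_of_iso e h⟩, fun i => X (i + 1), fun i => d (i + 1),
    fun i => w (i + 1), fun i => hX _, fun i => hd _, fun F hF i => hQ F hF (i + 1), ⟨Iso.refl _⟩⟩

lemma IsGorensteinProjective.perpProjective {G : ModuleCat.{u} R}
    (hG : IsGorensteinProjective R G) : PerpProjective G := by
  obtain ⟨X, d, w, hX, hd, hQ, ⟨e⟩⟩ := hG
  intro Q hQproj i
  suffices H : ∀ (i : ℕ) (j : ℤ), Subsingleton (Ext.{u} (image (d j)) Q (i + 1)) by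
    have := H i 0
    have (k : ℕ) : Subsingleton (Ext.{u} (0 : ModuleCat.{u} R) Q (1 + k)) := by
      rw [add_comm]
      exact Ext.subsingleton_of_projective _ _ _
    exact (HasSES.of_iso e).subsingleton_ext_left (i + 1)
  intro i
  induction i with
  | zero =>
    intro j
    obtain ⟨j, rfl⟩ : ∃ k : ℤ, j = k + 1 := ⟨j - 1, by ring⟩
    obtain ⟨j, rfl⟩ : ∃ k : ℤ, j = k + 1 := ⟨j - 1, by ring⟩
    obtain ⟨_, h⟩ := shortExact_image _ _ (w (j + 1)) (hd (j + 1))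
    have := hX (j + 1 + 1)
    have := Ext.subsingleton_of_projective.{u} (X (j + 1 + 1)) Q 0
    refine subsingleton_ext_one_of_forall_extension h fun k => ?_
    obtain ⟨l, hl⟩ := hQ Q hQproj j (factorThruImage (d (j + 1)) ≫ k) (by
      have : d j ≫ factorThruImage (d (j + 1)) = 0 := by
        rw [← cancel_mono (Limits.image.ι (d (j + 1)))]
        simp [w]
      rw [← Category.assoc, this, zero_comp])
    refine ⟨l, ?_⟩
    rw [← cancel_epi (factorThruImage (d (j + 1))), ← hl, image.fac_assoc]
  | succ i ih =>
    intro j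
    obtain ⟨j, rfl⟩ : ∃ k : ℤ, j = k + 1 := ⟨j - 1, by ring⟩
    obtain ⟨_, h⟩ := shortExact_image _ _ (w j) (hd j)
    have := ih j
    have := hX (j + 1)
    rw [add_comm (i + 1) 1]
    have : Subsingleton (Ext.{u} (X (j + 1)) Q (1 + (i + 1))) := by
      rw [add_comm]
      exact Ext.subsingleton_of_projective _ _ _
    exact HasSES.subsingleton_ext_right ⟨_, _, _, h⟩ (i + 1)

lemma IsGorensteinProjective.of_projective (P : ModuleCat.{u} R) [hP : Projective P] :
    IsGorensteinProjective R P := by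
  refine isGorensteinProjective_of_class (fun P => Projective P)
    (fun P _ => .of_projective P) (fun P hP => ?_) hP
  exact ⟨P, 0, hP, .of_iso (Iso.refl P), inferInstance⟩

/-- Gorenstein projective modules are closed under extensions. -/
lemma IsGorensteinProjective.extension {X Y Z : ModuleCat.{u} R} (h : HasSES X Y Z)
    (hX : IsGorensteinProjective R X) (hZ : IsGorensteinProjective R Z) :
    IsGorensteinProjective R Y := by
  refine isGorensteinProjective_of_class (fun Y => ∃ X Z, HasSES X Y Z ∧
    IsGorensteinProjective R X ∧ IsGorensteinProjective R Z)
    ?_ ?_ ⟨X, Z, h, hX, hZ⟩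
  · rintro Y ⟨X, Z, h, hX, hZ⟩
    exact .middle h hX.perpProjective hZ.perpProjective
  · rintro Y ⟨X, Z, h, hX, hZ⟩
    obtain ⟨P, X', hP, hPX, hX'⟩ := hX.exists_cosyzygy
    obtain ⟨P', Z', hP', hPZ, hZ'⟩ := hZ.exists_cosyzygy
    obtain ⟨E, ⟨f, g, w, hE⟩, hYE⟩ := h.pushout hPX
    have : Subsingleton (Ext.{u} Z P 1) := hZ.perpProjective P hP 0
    obtain ⟨r, hr⟩ := exists_extension hE (𝟙 P)
    have : Mono (ShortComplex.mk f g w).f := hE.mono_f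
    have : Epi (ShortComplex.mk f g w).g := hE.epi_g
    have hswap : HasSES Z E P :=
      .swap_of_splitting (ShortComplex.Splitting.ofExactOfRetraction _ hE.exact r hr this)
    obtain ⟨F, hF, hEF⟩ := hswap.pushout hPZ
    obtain ⟨C, hC, hC'⟩ := hYE.quotient hEF
    exact ⟨F, C, hF.projective, hC, X', Z', hC', hX', hZ'⟩

lemma IsGorensteinProjective.of_hasSES_projective {A B T : ModuleCat.{u} R} (h : HasSES A B T)
    [hB : Projective B] (hT : IsGorensteinProjective R T) : IsGorensteinProjective R A := by
  refine isGorensteinProjective_of_class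
    (fun A => IsGorensteinProjective R A ∨ ∃ B T : ModuleCat.{u} R, HasSES A B T ∧
      Projective B ∧ IsGorensteinProjective R T) ?_ ?_ (.inr ⟨B, T, h, hB, hT⟩)
  · rintro A (hA | ⟨B, T, h, hB, hT⟩)
    · exact hA.perpProjective
    · exact .left h (.of_projective B) hT.perpProjective
  · rintro A (hA | ⟨B, T, h, hB, hT⟩)
    · obtain ⟨P, G, hP, h, hG⟩ := hA.exists_cosyzygy
      exact ⟨P, G, hP, h, .inl hG⟩
    · exact ⟨B, T, hB, h, .inl hT⟩

lemma Res.mono {P Q : ModuleCat.{u} R → Prop} (hPQ : ∀ X, P X → Q X) {n : ℕ}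
    {K A : ModuleCat.{u} R} (h : Res P n K A) : Res Q n K A := by
  induction n generalizing A with
  | zero => exact h
  | succ n ih =>
    obtain ⟨B, X, f, g, w, hX, hS, hW, h⟩ := h
    exact ⟨B, X, f, g, w, hPQ X hX, hS, hW, ih h⟩

lemma exists_hasSES_of_res {n : ℕ} {K A : ModuleCat.{u} R} (hK : IsGorensteinProjective R K)
    (h : Res (IsGorensteinProjective R) n K A) :
    ∃ B T L : ModuleCat.{u} R, HasSES A B T ∧ IsGorensteinProjective R T ∧
      Projective L ∧ Res (fun P => Projective P) n L B := by
  induction n generalizing A with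
  | zero =>
    obtain ⟨e⟩ := h
    obtain ⟨P, T, hP, hS, hT⟩ := (hK.of_iso e.symm).exists_cosyzygy
    exact ⟨P, T, P, hS, hT, hP, ⟨Iso.refl P⟩⟩
  | succ n ih =>
    obtain ⟨A', G, f, g, w, hG, hS, -, h⟩ := h
    obtain ⟨B', T', L, hA', hT', hL, hres⟩ := ih h
    obtain ⟨G', hBG, hGG⟩ := HasSES.pushout ⟨f, g, w, hS⟩ hA'
    obtain ⟨P, T, hP, hGP, hT⟩ := (IsGorensteinProjective.extension hGG hG hT').exists_cosyzygy
    obtain ⟨B, ⟨i, p, w', hB⟩, hAB⟩ := hBG.quotient hGP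
    exact ⟨B, T, L, hAB, hT, hL, B', P, i, p, w', hP, hB, trivial, hres⟩

lemma exists_res_of_hasSES {n : ℕ} {A B T K : ModuleCat.{u} R} (h : HasSES A B T)
    (hT : IsGorensteinProjective R T) (hK : Projective K)
    (hres : Res (fun P => Projective P) n K B) :
    ∃ L, IsGorensteinProjective R L ∧ Res (IsGorensteinProjective R) n L A := by
  cases n with
  | zero =>
    obtain ⟨e⟩ := hres
    have : Projective B := Projective.of_iso e hK
    exact ⟨A, .of_hasSES_projective h hT, ⟨Iso.refl A⟩⟩
  | succ n =>
    obtain ⟨B', P, f, g, w, hP, hS, -, hres⟩ := hres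
    obtain ⟨G, hG, ⟨i, p, w', hA⟩⟩ := HasSES.preimage ⟨f, g, w, hS⟩ h
    exact ⟨K, .of_projective K, B', G, i, p, w', .of_hasSES_projective hG hT, hA, trivial,
      Res.mono (fun X (_ : Projective X) => .of_projective X) hres⟩

end GorensteinProjective

end RelHomDim

open RelHomDim in
/-- Corollary 5.9(1). -/
theorem stmt19 (R : Type u) [Ring R] (A : ModuleCat.{u} R) (n : ℕ)
    (hA : rdim (IsGorensteinProjective R) A = (n : ℕ∞)) :
    ∃ (B T : ModuleCat.{u} R) (f : A ⟶ B) (g : B ⟶ T) (w : f ≫ g = 0),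
      (ShortComplex.mk f g w).ShortExact ∧
      rdim (fun P : ModuleCat.{u} R => Projective P) B = (n : ℕ∞) ∧
      IsGorensteinProjective R T := by
  obtain ⟨m, hm, K, hK, hres⟩ : (n : ℕ∞) ∈ {c : ℕ∞ | ∃ n : ℕ, c = n ∧
      ∃ K, IsGorensteinProjective R K ∧ Res (IsGorensteinProjective R) n K A} := by
    rw [← hA]
    refine csInf_mem (Set.nonempty_iff_ne_empty.2 fun hempty => ?_)
    rw [rdim, hempty, sInf_empty] at hA
    exact ENat.top_ne_natCast n hA
  obtain rfl : n = m := by exact_mod_cast hm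
  obtain ⟨B, T, L, hS, hT, hL, hB⟩ := exists_hasSES_of_res hK hres
  obtain ⟨f, g, w, h⟩ := id hS
  refine ⟨B, T, f, g, w, h, le_antisymm (sInf_le ⟨n, rfl, L, hL, hB⟩) (le_sInf ?_), hT⟩
  rintro _ ⟨m, rfl, K', hK', hres'⟩
  rw [← hA]
  obtain ⟨L', hL', hA'⟩ := exists_res_of_hasSES hS hT hK' hres'
  exact sInf_le ⟨m, rfl, L', hL', hA'⟩
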